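/- Let g be a metric on U, let Q be a smooth field of symmetric n×n matrices on U, and let V be a smooth vector field on U. Define the operator Q̂ f := |det g|^{−1/2} Σ_{i,j} ∂_i(|det g|^{1/2} Q^{ij} ∂_j f) + Σ_ℓ V^ℓ ∂_ℓ f on smooth functions. If Q̂ commutes with the Beltrami–Laplace operator Δ_g, i.e., Δ_g(Q̂ f) = Q̂(Δ_g f) for every smooth f : U → ℝ, then the (0,2)-tensor field g·Q·g (the matrix field x ↦ g(x) Q(x) g(x)) is a Killing tensor for g. -/

import Mathlib

open Matrix

noncomputable section

/-- Partial derivative in the `i`-th coordinate direction of a real-valued function on `ℝⁿ`. -/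
def pd {n : ℕ} (i : Fin n) (f : (Fin n → ℝ) → ℝ) : (Fin n → ℝ) → ℝ :=
  fun x => fderiv ℝ f x (Pi.single i 1)

/-- Iterated partial derivatives along a list of coordinate directions. -/
def iterPD {n : ℕ} : List (Fin n) → ((Fin n → ℝ) → ℝ) → ((Fin n → ℝ) → ℝ)
  | [], f => f
  | i :: l, f => pd i (iterPD l f)

/-- `g` is a (pseudo-Riemannian) metric on `U`: a smooth field of invertible symmetric
real `n×n` matrices. -/
structure IsMetricOn {n : ℕ} (U : Set (Fin n → ℝ))
    (g : (Fin n → ℝ) → Matrix (Fin n) (Fin n) ℝ) : Prop where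
  smooth : ∀ i j : Fin n, ContDiffOn ℝ (⊤ : ℕ∞) (fun x => g x i j) U
  symm : ∀ x ∈ U, (g x).IsSymm
  nondeg : ∀ x ∈ U, IsUnit (g x).det

/-- The Christoffel symbols `Γ^k_{ij}` of the metric `g`. -/
def Gamma {n : ℕ} (g : (Fin n → ℝ) → Matrix (Fin n) (Fin n) ℝ)
    (k i j : Fin n) (x : Fin n → ℝ) : ℝ :=
  (1/2) * ∑ ℓ, (g x)⁻¹ k ℓ *
    (pd i (fun y => g y ℓ j) x + pd j (fun y => g y ℓ i) x - pd ℓ (fun y => g y i j) x)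

/-- An open interval of `ℝ` (possibly empty or unbounded): an open order-connected set. -/
def IsOpenInterval (I : Set ℝ) : Prop := IsOpen I ∧ I.OrdConnected

/-- `γ` is a `g`-geodesic defined on the open interval `I`, with values in `U`. -/
structure IsGeodesicOn {n : ℕ} (U : Set (Fin n → ℝ))
    (g : (Fin n → ℝ) → Matrix (Fin n) (Fin n) ℝ)
    (γ : ℝ → (Fin n → ℝ)) (I : Set ℝ) : Prop where
  interval : IsOpenInterval I
  smooth : ∀ k : Fin n, ContDiffOn ℝ (⊤ : ℕ∞) (fun s => γ s k) I
  mem : ∀ t ∈ I, γ t ∈ U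
  eqn : ∀ t ∈ I, ∀ k : Fin n,
    deriv (deriv fun s => γ s k) t
      + ∑ i, ∑ j, Gamma g k i j (γ t) * deriv (fun s => γ s i) t * deriv (fun s => γ s j) t = 0

/-- `g` and `gbar` are projectively equivalent on `U`: every `g`-geodesic with nowhere
vanishing velocity becomes, after a smooth reparameterization (a diffeomorphism of open
intervals), a `gbar`-geodesic. -/
def ProjEquiv {n : ℕ} (U : Set (Fin n → ℝ))
    (g gbar : (Fin n → ℝ) → Matrix (Fin n) (Fin n) ℝ) : Prop :=
  ∀ (γ : ℝ → (Fin n → ℝ)) (I : Set ℝ), IsGeodesicOn U g γ I →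
    (∀ t ∈ I, ∃ k, deriv (fun s => γ s k) t ≠ 0) →
    ∃ (φ : ℝ → ℝ) (J : Set ℝ), IsOpenInterval J ∧ ContDiffOn ℝ (⊤ : ℕ∞) φ J ∧
      Set.InjOn φ J ∧ φ '' J = I ∧ (∀ t ∈ J, deriv φ t ≠ 0) ∧
      IsGeodesicOn U gbar (γ ∘ φ) J

/-- The (1,1)-tensor `L = |det gbar / det g|^{1/(n+1)} gbar⁻¹ g` built from `g` and `gbar`. -/
def Lfield {n : ℕ} (g gbar : (Fin n → ℝ) → Matrix (Fin n) (Fin n) ℝ)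
    (x : Fin n → ℝ) : Matrix (Fin n) (Fin n) ℝ :=
  |(gbar x).det / (g x).det| ^ ((1 : ℝ)/((n : ℝ)+1)) • ((gbar x)⁻¹ * g x)

/-- The family `S(t) = adjugate (t·Id − L)`. -/
def Sfield {n : ℕ} (g gbar : (Fin n → ℝ) → Matrix (Fin n) (Fin n) ℝ) (t : ℝ)
    (x : Fin n → ℝ) : Matrix (Fin n) (Fin n) ℝ :=
  (t • (1 : Matrix (Fin n) (Fin n) ℝ) - Lfield g gbar x).adjugate

/-- The second order operator associated (via Carter's quantization) to a field `A` of
symmetric matrices: `Â f = |det g|^{-1/2} ∑ᵢⱼ ∂ᵢ(|det g|^{1/2} Aⁱʲ ∂ⱼ f)`. -/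
def assocOp {n : ℕ} (g A : (Fin n → ℝ) → Matrix (Fin n) (Fin n) ℝ)
    (f : (Fin n → ℝ) → ℝ) (x : Fin n → ℝ) : ℝ :=
  |(g x).det| ^ (-(1 : ℝ)/2) * ∑ i, ∑ j,
    pd i (fun y => |(g y).det| ^ ((1 : ℝ)/2) * A y i j * pd j f y) x

/-- The operator `K̂^{(t)}`, associated to `A = S(t)·g⁻¹`. -/
def Khat {n : ℕ} (g gbar : (Fin n → ℝ) → Matrix (Fin n) (Fin n) ℝ) (t : ℝ)
    (f : (Fin n → ℝ) → ℝ) (x : Fin n → ℝ) : ℝ :=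
  assocOp g (fun y => Sfield g gbar t y * (g y)⁻¹) f x

/-- The Beltrami-Laplace operator of `g`, associated to `A = g⁻¹`. -/
def LaplaceOp {n : ℕ} (g : (Fin n → ℝ) → Matrix (Fin n) (Fin n) ℝ)
    (f : (Fin n → ℝ) → ℝ) (x : Fin n → ℝ) : ℝ :=
  assocOp g (fun y => (g y)⁻¹) f x

/-- `K` is a Killing tensor for `g` on `U`: the associated quadratic function is constant
along every `g`-geodesic. -/
def IsKillingTensorOn {n : ℕ} (U : Set (Fin n → ℝ))
    (g K : (Fin n → ℝ) → Matrix (Fin n) (Fin n) ℝ) : Prop :=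
  ∀ (γ : ℝ → (Fin n → ℝ)) (I : Set ℝ), IsGeodesicOn U g γ I →
    ∀ τ₁ ∈ I, ∀ τ₂ ∈ I,
      (∑ i, ∑ j, deriv (fun s => γ s i) τ₁ * K (γ τ₁) i j * deriv (fun s => γ s j) τ₁) =
      (∑ i, ∑ j, deriv (fun s => γ s i) τ₂ * K (γ τ₂) i j * deriv (fun s => γ s j) τ₂)

/-- The covariant derivative `∇_k T_{ij}` of a (0,2)-tensor field `T`. -/
def covDeriv2 {n : ℕ} (g T : (Fin n → ℝ) → Matrix (Fin n) (Fin n) ℝ)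
    (k i j : Fin n) (x : Fin n → ℝ) : ℝ :=
  pd k (fun y => T y i j) x - (∑ s, Gamma g s k i x * T x s j)
    - ∑ s, Gamma g s k j x * T x i s

/-- The Ricci curvature tensor `R_{ij}` of `g`. -/
def Ricci {n : ℕ} (g : (Fin n → ℝ) → Matrix (Fin n) (Fin n) ℝ)
    (i j : Fin n) (x : Fin n → ℝ) : ℝ :=
  (∑ ℓ, pd ℓ (fun y => Gamma g ℓ i j y) x) - (∑ ℓ, pd i (fun y => Gamma g ℓ ℓ j y) x)
    + ∑ ℓ, ∑ s, (Gamma g ℓ ℓ s x * Gamma g s i j x - Gamma g ℓ i s x * Gamma g s ℓ j x)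

/-- A function vanishes up to order `k` at `p`: it and all its partial derivatives of
order `≤ k` vanish at `p`. -/
def VanishUpTo {n : ℕ} (k : ℕ) (f : (Fin n → ℝ) → ℝ) (p : Fin n → ℝ) : Prop :=
  ∀ l : List (Fin n), l.length ≤ k → iterPD l f p = 0


/-- The plain (flat) second order operator `Â f = ∑ᵢⱼ ∂ᵢ(Aⁱʲ ∂ⱼ f)` associated to a
matrix field `A`. -/
def opPlain {n : ℕ} (A : (Fin n → ℝ) → Matrix (Fin n) (Fin n) ℝ)
    (f : (Fin n → ℝ) → ℝ) (x : Fin n → ℝ) : ℝ :=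
  ∑ i, ∑ j, pd i (fun y => A y i j * pd j f y) x

end


section PartialDerivatives

variable {n : ℕ}

theorem pd_add {i : Fin n} {f h : (Fin n → ℝ) → ℝ} {x : Fin n → ℝ}
    (hf : DifferentiableAt ℝ f x) (hh : DifferentiableAt ℝ h x) :
    pd i (fun y => f y + h y) x = pd i f x + pd i h x := by
  simp [pd, fderiv_fun_add hf hh]

theorem pd_mul {i : Fin n} {f h : (Fin n → ℝ) → ℝ} {x : Fin n → ℝ}
    (hf : DifferentiableAt ℝ f x) (hh : DifferentiableAt ℝ h x) :
    pd i (fun y => f y * h y) x = pd i f x * h x + f x * pd i h x := by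
  simp [pd, fderiv_fun_mul hf hh]
  ring

theorem pd_const_mul {i : Fin n} {f : (Fin n → ℝ) → ℝ} {x : Fin n → ℝ}
    (hf : DifferentiableAt ℝ f x) (c : ℝ) :
    pd i (fun y => c * f y) x = c * pd i f x := by
  simp [pd, fderiv_const_mul hf c]

theorem pd_sum {ι : Type*} {s : Finset ι} {i : Fin n} {f : ι → (Fin n → ℝ) → ℝ}
    {x : Fin n → ℝ} (hf : ∀ a ∈ s, DifferentiableAt ℝ (f a) x) :
    pd i (fun y => ∑ a ∈ s, f a y) x = ∑ a ∈ s, pd i (f a) x := by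
  simp [pd, fderiv_fun_sum hf]

theorem pd_congr {U : Set (Fin n → ℝ)} (hU : IsOpen U) {f h : (Fin n → ℝ) → ℝ}
    (hfh : Set.EqOn f h U) {x : Fin n → ℝ} (hx : x ∈ U) (i : Fin n) :
    pd i f x = pd i h x := by
  have : f =ᶠ[nhds x] h := hfh.eventuallyEq_of_mem (hU.mem_nhds hx)
  simp [pd, this.fderiv_eq]

theorem ContDiffOn.pd {U : Set (Fin n → ℝ)} (hU : IsOpen U) {f : (Fin n → ℝ) → ℝ}
    (hf : ContDiffOn ℝ (⊤ : ℕ∞) f U) (i : Fin n) :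
    ContDiffOn ℝ (⊤ : ℕ∞) (pd i f) U :=
  (hf.fderiv_of_isOpen hU (by simp)).clm_apply contDiffOn_const

theorem ContDiffOn.differentiableAt_of_isOpen {U : Set (Fin n → ℝ)} (hU : IsOpen U)
    {f : (Fin n → ℝ) → ℝ} (hf : ContDiffOn ℝ (⊤ : ℕ∞) f U) {x : Fin n → ℝ} (hx : x ∈ U) :
    DifferentiableAt ℝ f x :=
  (hf.contDiffAt (hU.mem_nhds hx)).differentiableAt (by simp)

theorem HasDerivAt.comp_pd {f : (Fin n → ℝ) → ℝ} {γ : ℝ → Fin n → ℝ} {v : Fin n → ℝ} {t : ℝ}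
    (hf : DifferentiableAt ℝ f (γ t)) (hγ : ∀ k, HasDerivAt (fun s => γ s k) (v k) t) :
    HasDerivAt (fun s => f (γ s)) (∑ k, v k * pd k f (γ t)) t := by
  have h := hf.hasFDerivAt.comp_hasDerivAt t (hasDerivAt_pi.2 hγ)
  have hv : fderiv ℝ f (γ t) v = ∑ k, v k * pd k f (γ t) := by
    conv_lhs => rw [← Finset.univ_sum_single v]
    rw [map_sum]
    refine Finset.sum_congr rfl fun k _ => ?_
    rw [show (Pi.single k (v k) : Fin n → ℝ) = v k • Pi.single k 1 by
      rw [← Pi.single_smul, smul_eq_mul, mul_one], map_smul, smul_eq_mul, pd]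
  rwa [hv] at h

/-- The entrywise partial derivative of a field of matrices. -/
noncomputable def pdMat (i : Fin n) (M : (Fin n → ℝ) → Matrix (Fin n) (Fin n) ℝ)
    (x : Fin n → ℝ) : Matrix (Fin n) (Fin n) ℝ :=
  Matrix.of fun a b => pd i (fun y => M y a b) x

theorem pd_quadratic {M : (Fin n → ℝ) → Matrix (Fin n) (Fin n) ℝ} {x : Fin n → ℝ}
    (hM : ∀ a b, DifferentiableAt ℝ (fun y => M y a b) x) (ξ : Fin n → ℝ) (i : Fin n) :
    pd i (fun y => ξ ⬝ᵥ M y *ᵥ ξ) x = ξ ⬝ᵥ pdMat i M x *ᵥ ξ := by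
  simp only [dotProduct, mulVec]
  rw [pd_sum (by fun_prop)]
  refine Finset.sum_congr rfl fun a _ => ?_
  rw [pd_const_mul (by fun_prop), pd_sum (by fun_prop)]
  refine congrArg _ (Finset.sum_congr rfl fun b _ => ?_)
  simp_rw [mul_comm _ (ξ b)]
  rw [pd_const_mul (hM a b)]
  rfl

theorem pdMat_mul {M N : (Fin n → ℝ) → Matrix (Fin n) (Fin n) ℝ} {x : Fin n → ℝ}
    (hM : ∀ a b, DifferentiableAt ℝ (fun y => M y a b) x)
    (hN : ∀ a b, DifferentiableAt ℝ (fun y => N y a b) x) (i : Fin n) :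
    pdMat i (fun y => M y * N y) x = pdMat i M x * N x + M x * pdMat i N x := by
  ext a b
  simp only [pdMat, Matrix.mul_apply, Matrix.of_apply, Matrix.add_apply]
  rw [pd_sum fun c _ => (hM a c).fun_mul (hN c b), ← Finset.sum_add_distrib]
  exact Finset.sum_congr rfl fun c _ => pd_mul (hM a c) (hN c b)

end PartialDerivatives

section Smoothness

variable {n : ℕ} {U : Set (Fin n → ℝ)}

theorem ContDiffOn.matrix_det {M : (Fin n → ℝ) → Matrix (Fin n) (Fin n) ℝ}
    (hM : ∀ i j, ContDiffOn ℝ (⊤ : ℕ∞) (fun x => M x i j) U) :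
    ContDiffOn ℝ (⊤ : ℕ∞) (fun x => (M x).det) U := by
  simp only [Matrix.det_apply']
  exact ContDiffOn.sum fun σ _ => contDiffOn_const.mul (contDiffOn_prod fun i _ => hM _ _)

theorem IsMetricOn.contDiffOn_inv {g : (Fin n → ℝ) → Matrix (Fin n) (Fin n) ℝ}
    (hg : IsMetricOn U g) (i j : Fin n) :
    ContDiffOn ℝ (⊤ : ℕ∞) (fun x => (g x)⁻¹ i j) U := by
  simp only [Matrix.inv_def, Matrix.smul_apply, Ring.inverse_eq_inv', smul_eq_mul,
    Matrix.adjugate_apply]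
  refine ((ContDiffOn.matrix_det hg.smooth).inv fun x hx => (hg.nondeg x hx).ne_zero).mul
    (ContDiffOn.matrix_det fun a b => ?_)
  by_cases h : a = j
  · subst h
    simpa using contDiffOn_const
  · simpa [Matrix.updateRow_ne h] using hg.smooth a b

theorem IsMetricOn.contDiffOn_abs_det_rpow {g : (Fin n → ℝ) → Matrix (Fin n) (Fin n) ℝ}
    (hg : IsMetricOn U g) (r : ℝ) :
    ContDiffOn ℝ (⊤ : ℕ∞) (fun x => |(g x).det| ^ r) U := by
  intro x hx
  have hx0 : (g x).det ≠ 0 := (hg.nondeg x hx).ne_zero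
  have habs : ContDiffWithinAt ℝ (⊤ : ℕ∞) (fun y => |(g y).det|) U x :=
    (contDiffAt_abs hx0).comp_contDiffWithinAt (f := fun y => (g y).det) x
      (ContDiffOn.matrix_det hg.smooth x hx)
  exact habs.rpow_const_of_ne (abs_ne_zero.2 hx0)

end Smoothness

section Symbols

variable {n : ℕ} {U : Set (Fin n → ℝ)}
  {g A : (Fin n → ℝ) → Matrix (Fin n) (Fin n) ℝ}

/-- The first order coefficients of the operator `assocOp g A`. -/
noncomputable def drift (g A : (Fin n → ℝ) → Matrix (Fin n) (Fin n) ℝ)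
    (x : Fin n → ℝ) (j : Fin n) : ℝ :=
  |(g x).det| ^ (-(1 : ℝ)/2) * ∑ i, pd i (fun y => |(g y).det| ^ ((1 : ℝ)/2) * A y i j) x

theorem contDiffOn_drift (hU : IsOpen U) (hg : IsMetricOn U g)
    (hA : ∀ i j, ContDiffOn ℝ (⊤ : ℕ∞) (fun x => A x i j) U) (j : Fin n) :
    ContDiffOn ℝ (⊤ : ℕ∞) (fun x => drift g A x j) U :=
  (hg.contDiffOn_abs_det_rpow _).mul <| ContDiffOn.sum fun i _ =>
    ((hg.contDiffOn_abs_det_rpow _).mul (hA i j)).pd hU i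

theorem assocOp_eq_sum (hU : IsOpen U) (hg : IsMetricOn U g)
    (hA : ∀ i j, ContDiffOn ℝ (⊤ : ℕ∞) (fun x => A x i j) U)
    {h : (Fin n → ℝ) → ℝ} (hh : ContDiffOn ℝ (⊤ : ℕ∞) h U) {x : Fin n → ℝ} (hx : x ∈ U) :
    assocOp g A h x =
      ∑ i, ∑ j, A x i j * pd i (pd j h) x + ∑ j, drift g A x j * pd j h x := by
  have hpos : 0 < |(g x).det| := abs_pos.2 (hg.nondeg x hx).ne_zero
  have hw : |(g x).det| ^ (-(1 : ℝ)/2) * |(g x).det| ^ ((1 : ℝ)/2) = 1 := by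
    rw [← Real.rpow_add hpos]
    norm_num
  have hprod : ∀ i j, pd i (fun y => |(g y).det| ^ ((1 : ℝ)/2) * A y i j * pd j h y) x =
      pd i (fun y => |(g y).det| ^ ((1 : ℝ)/2) * A y i j) x * pd j h x +
        |(g x).det| ^ ((1 : ℝ)/2) * A x i j * pd i (pd j h) x := fun i j =>
    pd_mul (((hg.contDiffOn_abs_det_rpow _).mul (hA i j)).differentiableAt_of_isOpen hU hx)
      ((hh.pd hU j).differentiableAt_of_isOpen hU hx)
  simp only [assocOp, drift, hprod, Finset.sum_add_distrib, mul_add]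
  rw [add_comm]
  congr 1
  · simp only [Finset.mul_sum]
    refine Finset.sum_congr rfl fun i _ => Finset.sum_congr rfl fun j _ => ?_
    rw [← mul_assoc, ← mul_assoc, hw, one_mul]
  · rw [Finset.sum_comm]
    simp only [Finset.mul_sum, Finset.sum_mul, mul_assoc]

theorem assocOp_cube (hU : IsOpen U) (hg : IsMetricOn U g)
    (hA : ∀ i j, ContDiffOn ℝ (⊤ : ℕ∞) (fun x => A x i j) U)
    {φ : (Fin n → ℝ) → ℝ} (hφ : ContDiff ℝ (⊤ : ℕ∞) φ) {ξ : Fin n → ℝ}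
    (hξ : ∀ i y, pd i φ y = ξ i) {x : Fin n → ℝ} (hx : x ∈ U) :
    assocOp g A (fun y => φ y * (φ y * φ y)) x =
      6 * (φ x * (ξ ⬝ᵥ A x *ᵥ ξ)) + 3 * (φ x * φ x * (drift g A x ⬝ᵥ ξ)) := by
  have hd : ∀ y, DifferentiableAt ℝ φ y := fun y => hφ.contDiffAt.differentiableAt (by simp)
  have h1 : ∀ j, pd j (fun y => φ y * (φ y * φ y)) = fun y => 3 * ξ j * (φ y * φ y) := by
    intro j
    ext y
    rw [pd_mul (hd y) ((hd y).fun_mul (hd y)), pd_mul (hd y) (hd y), hξ]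
    ring
  have h2 : ∀ i j, pd i (fun y => 3 * ξ j * (φ y * φ y)) x = 6 * (ξ i * ξ j * φ x) := by
    intro i j
    rw [pd_const_mul ((hd x).fun_mul (hd x)), pd_mul (hd x) (hd x), hξ]
    ring
  rw [assocOp_eq_sum hU hg hA (hφ.mul (hφ.mul hφ)).contDiffOn hx]
  simp only [h1, h2, dotProduct, mulVec, Finset.mul_sum]
  congr 1
  · exact Finset.sum_congr rfl fun i _ => Finset.sum_congr rfl fun j _ => by ring
  · exact Finset.sum_congr rfl fun j _ => by ring

theorem pd_of_eqOn (hU : IsOpen U) {φ : (Fin n → ℝ) → ℝ} (hφ : ContDiff ℝ (⊤ : ℕ∞) φ)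
    {ξ : Fin n → ℝ} (hξ : ∀ i y, pd i φ y = ξ i) {h β κ : (Fin n → ℝ) → ℝ}
    (hβ : ContDiffOn ℝ (⊤ : ℕ∞) β U) (hκ : ContDiffOn ℝ (⊤ : ℕ∞) κ U)
    (hh : Set.EqOn h (fun y => 6 * (φ y * β y) + 3 * (φ y * φ y * κ y)) U) (j : Fin n) :
    Set.EqOn (pd j h) (fun y => 6 * (ξ j * β y + φ y * pd j β y) +
      3 * (2 * ξ j * (φ y * κ y) + φ y * (φ y * pd j κ y))) U := by
  intro y hy
  have dβ := hβ.differentiableAt_of_isOpen hU hy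
  have dκ := hκ.differentiableAt_of_isOpen hU hy
  have dφ : DifferentiableAt ℝ φ y := hφ.contDiffAt.differentiableAt (by simp)
  rw [pd_congr hU hh hy, pd_add (by fun_prop) (by fun_prop), pd_const_mul (by fun_prop),
    pd_const_mul (by fun_prop), pd_mul dφ dβ, pd_mul (by fun_prop) dκ, pd_mul dφ dφ, hξ]
  ring

theorem assocOp_of_eqOn (hU : IsOpen U) (hg : IsMetricOn U g)
    (hA : ∀ i j, ContDiffOn ℝ (⊤ : ℕ∞) (fun x => A x i j) U)
    {φ : (Fin n → ℝ) → ℝ} (hφ : ContDiff ℝ (⊤ : ℕ∞) φ) {ξ : Fin n → ℝ}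
    (hξ : ∀ i y, pd i φ y = ξ i) {p : Fin n → ℝ} (hp : p ∈ U) (hAp : (A p).IsSymm)
    (hφp : φ p = 0) {h β κ : (Fin n → ℝ) → ℝ} (hβ : ContDiffOn ℝ (⊤ : ℕ∞) β U)
    (hκ : ContDiffOn ℝ (⊤ : ℕ∞) κ U)
    (hh : Set.EqOn h (fun y => 6 * (φ y * β y) + 3 * (φ y * φ y * κ y)) U) :
    assocOp g A h p = 12 * ∑ i, ∑ j, A p i j * ξ i * pd j β p +
      6 * (ξ ⬝ᵥ A p *ᵥ ξ) * κ p + 6 * (drift g A p ⬝ᵥ ξ) * β p := by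
  have hd : ∀ y, DifferentiableAt ℝ φ y := fun y => hφ.contDiffAt.differentiableAt (by simp)
  have hm : ContDiffOn ℝ (⊤ : ℕ∞) (fun y => 6 * (φ y * β y) + 3 * (φ y * φ y * κ y)) U := by
    have := hφ.contDiffOn (s := U)
    fun_prop
  have h1 := pd_of_eqOn hU hφ hξ hβ hκ hh
  have h2 : ∀ i j, pd i (pd j h) p =
      6 * (ξ j * pd i β p) + 6 * (ξ i * pd j β p) + 6 * (ξ i * ξ j * κ p) := by
    intro i j
    have dβ := hβ.differentiableAt_of_isOpen hU hp
    have dκ := hκ.differentiableAt_of_isOpen hU hp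
    have dβ' := (hβ.pd hU j).differentiableAt_of_isOpen hU hp
    have dκ' := (hκ.pd hU j).differentiableAt_of_isOpen hU hp
    have dφ := hd p
    rw [pd_congr hU (h1 j) hp, pd_add (by fun_prop) (by fun_prop), pd_const_mul (by fun_prop),
      pd_const_mul (by fun_prop), pd_add (by fun_prop) (by fun_prop),
      pd_add (by fun_prop) (by fun_prop), pd_const_mul dβ, pd_mul dφ dβ',
      pd_const_mul (by fun_prop), pd_mul dφ dκ, pd_mul dφ (by fun_prop), hξ, hφp,
      pd_mul dφ dκ', hφp]
    ring
  have h3 : ∀ j, pd j h p = 6 * (ξ j * β p) := by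
    intro j
    rw [h1 j hp]
    simp [hφp]
  have hsymm : ∑ i, ∑ j, A p i j * ξ j * pd i β p = ∑ i, ∑ j, A p i j * ξ i * pd j β p := by
    rw [Finset.sum_comm]
    refine Finset.sum_congr rfl fun i _ => Finset.sum_congr rfl fun j _ => ?_
    rw [hAp.apply i j]
  have hsplit : ∑ i, ∑ j, A p i j *
        (6 * (ξ j * pd i β p) + 6 * (ξ i * pd j β p) + 6 * (ξ i * ξ j * κ p)) =
      6 * ∑ i, ∑ j, A p i j * ξ j * pd i β p + 6 * ∑ i, ∑ j, A p i j * ξ i * pd j β p +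
        6 * (ξ ⬝ᵥ A p *ᵥ ξ) * κ p := by
    simp only [dotProduct, mulVec, Finset.mul_sum, Finset.sum_mul, ← Finset.sum_add_distrib]
    exact Finset.sum_congr rfl fun i _ => Finset.sum_congr rfl fun j _ => by ring
  have hdrift : ∑ j, drift g A p j * (6 * (ξ j * β p)) = 6 * (drift g A p ⬝ᵥ ξ) * β p := by
    simp only [dotProduct, Finset.mul_sum, Finset.sum_mul]
    exact Finset.sum_congr rfl fun j _ => by ring
  rw [assocOp_eq_sum hU hg hA (hm.congr hh) hp]
  simp only [h2, h3]
  rw [hsplit, hsymm, hdrift]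
  ring

end Symbols

section Commutator

variable {n : ℕ} {U : Set (Fin n → ℝ)} {g : (Fin n → ℝ) → Matrix (Fin n) (Fin n) ℝ}

theorem ContDiffOn.quadratic {M : (Fin n → ℝ) → Matrix (Fin n) (Fin n) ℝ}
    (hM : ∀ i j, ContDiffOn ℝ (⊤ : ℕ∞) (fun x => M x i j) U) (ξ : Fin n → ℝ) :
    ContDiffOn ℝ (⊤ : ℕ∞) (fun x => ξ ⬝ᵥ M x *ᵥ ξ) U := by
  simp only [dotProduct, mulVec]
  fun_prop

theorem ContDiffOn.dotProduct_const {W : (Fin n → ℝ) → Fin n → ℝ}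
    (hW : ∀ i, ContDiffOn ℝ (⊤ : ℕ∞) (fun x => W x i) U) (ξ : Fin n → ℝ) :
    ContDiffOn ℝ (⊤ : ℕ∞) (fun x => W x ⬝ᵥ ξ) U := by
  simp only [dotProduct]
  fun_prop

/-- The vanishing of the third order symbol of the commutator of `LaplaceOp g` with
`assocOp g Q + V`: the quadratic forms of `g⁻¹` and `Q` on covectors Poisson commute. -/
theorem symbols_poisson_commute (hU : IsOpen U) (hg : IsMetricOn U g)
    {Q : (Fin n → ℝ) → Matrix (Fin n) (Fin n) ℝ}
    (hQs : ∀ i j, ContDiffOn ℝ (⊤ : ℕ∞) (fun x => Q x i j) U)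
    (hQsym : ∀ x ∈ U, (Q x).IsSymm) {V : (Fin n → ℝ) → Fin n → ℝ}
    (hVs : ∀ ℓ, ContDiffOn ℝ (⊤ : ℕ∞) (fun x => V x ℓ) U)
    (hcomm : ∀ f : (Fin n → ℝ) → ℝ, ContDiffOn ℝ (⊤ : ℕ∞) f U → ∀ x ∈ U,
      LaplaceOp g (fun y => assocOp g Q f y + ∑ ℓ, V y ℓ * pd ℓ f y) x =
        assocOp g Q (LaplaceOp g f) x + ∑ ℓ, V x ℓ * pd ℓ (LaplaceOp g f) x)
    {p : Fin n → ℝ} (hp : p ∈ U) (ξ : Fin n → ℝ) :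
    ∑ i, ∑ j, (g p)⁻¹ i j * ξ i * (ξ ⬝ᵥ pdMat j Q p *ᵥ ξ) =
      ∑ i, ∑ j, Q p i j * ξ i * (ξ ⬝ᵥ pdMat j (fun y => (g y)⁻¹) p *ᵥ ξ) := by
  have hinv := hg.contDiffOn_inv
  have hinvsym : ((g p)⁻¹).IsSymm := by
    rw [Matrix.IsSymm, Matrix.transpose_nonsing_inv, hg.symm p hp]
  set L : (Fin n → ℝ) →L[ℝ] ℝ := ∑ k, ξ k • ContinuousLinearMap.proj k
  set φ : (Fin n → ℝ) → ℝ := fun y => L y - L p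
  have hφ : ContDiff ℝ (⊤ : ℕ∞) φ := L.contDiff.sub contDiff_const
  have hξ : ∀ i y, pd i φ y = ξ i := by
    intro i y
    have : fderiv ℝ φ y = L := by
      simp only [φ, fderiv_sub_const, ContinuousLinearMap.fderiv]
    simp [pd, this, L, Pi.single_apply]
  have hφp : φ p = 0 := sub_self _
  have hd : ∀ y, DifferentiableAt ℝ φ y := fun y => hφ.contDiffAt.differentiableAt (by simp)
  have hcube : ∀ j y, pd j (fun y => φ y * (φ y * φ y)) y = 3 * (φ y * φ y * ξ j) := by
    intro j y
    rw [pd_mul (hd y) ((hd y).fun_mul (hd y)), pd_mul (hd y) (hd y), hξ]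
    ring
  have hβ := ContDiffOn.quadratic hinv ξ
  have hβ' := ContDiffOn.quadratic hQs ξ
  have hκ := ContDiffOn.dotProduct_const (contDiffOn_drift hU hg hinv) ξ
  have hκ' : ContDiffOn ℝ (⊤ : ℕ∞) (fun y => drift g Q y ⬝ᵥ ξ + V y ⬝ᵥ ξ) U :=
    (ContDiffOn.dotProduct_const (contDiffOn_drift hU hg hQs) ξ).add
      (ContDiffOn.dotProduct_const hVs ξ)
  have hLap : Set.EqOn (LaplaceOp g fun y => φ y * (φ y * φ y))
      (fun y => 6 * (φ y * (ξ ⬝ᵥ (g y)⁻¹ *ᵥ ξ)) +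
        3 * (φ y * φ y * (drift g (fun z => (g z)⁻¹) y ⬝ᵥ ξ))) U :=
    fun y hy => assocOp_cube hU hg hinv hφ hξ hy
  have hOp : Set.EqOn
      (fun y => assocOp g Q (fun y => φ y * (φ y * φ y)) y +
        ∑ ℓ, V y ℓ * pd ℓ (fun y => φ y * (φ y * φ y)) y)
      (fun y => 6 * (φ y * (ξ ⬝ᵥ Q y *ᵥ ξ)) +
        3 * (φ y * φ y * (drift g Q y ⬝ᵥ ξ + V y ⬝ᵥ ξ))) U := by
    intro y hy
    have hV : ∑ ℓ, V y ℓ * pd ℓ (fun y => φ y * (φ y * φ y)) y =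
        3 * (φ y * φ y * (V y ⬝ᵥ ξ)) := by
      simp only [hcube, dotProduct, Finset.mul_sum]
      exact Finset.sum_congr rfl fun j _ => by ring
    simp only [hV, assocOp_cube hU hg hQs hφ hξ hy]
    ring
  have hVLap : ∑ ℓ, V p ℓ * pd ℓ (LaplaceOp g fun y => φ y * (φ y * φ y)) p =
      6 * (V p ⬝ᵥ ξ) * (ξ ⬝ᵥ (g p)⁻¹ *ᵥ ξ) := by
    have : ∀ ℓ, pd ℓ (LaplaceOp g fun y => φ y * (φ y * φ y)) p =
        6 * (ξ ℓ * (ξ ⬝ᵥ (g p)⁻¹ *ᵥ ξ)) := by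
      intro ℓ
      rw [pd_of_eqOn hU hφ hξ hβ hκ hLap ℓ hp]
      simp [hφp]
    simp only [this]
    generalize ξ ⬝ᵥ (g p)⁻¹ *ᵥ ξ = c
    rw [dotProduct, Finset.mul_sum, Finset.sum_mul]
    exact Finset.sum_congr rfl fun j _ => by ring
  have key := hcomm (fun y => φ y * (φ y * φ y)) (hφ.mul (hφ.mul hφ)).contDiffOn p hp
  rw [hVLap, assocOp_of_eqOn hU hg hQs hφ hξ hp (hQsym p hp) hφp hβ hκ hLap, LaplaceOp,
    assocOp_of_eqOn hU hg hinv hφ hξ hp hinvsym hφp hβ' hκ' hOp] at key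
  have hpdQ := fun j => pd_quadratic
    (fun a b => (hQs a b).differentiableAt_of_isOpen hU hp) ξ j
  have hpdinv := fun j => pd_quadratic (M := fun y => (g y)⁻¹)
    (fun a b => (hinv a b).differentiableAt_of_isOpen hU hp) ξ j
  simp only [hpdQ, hpdinv] at key
  linarith

end Commutator

section Geodesics

variable {n : ℕ} {U : Set (Fin n → ℝ)} {g : (Fin n → ℝ) → Matrix (Fin n) (Fin n) ℝ}

theorem IsMetricOn.mul_pdMat_inv_mul (hU : IsOpen U) (hg : IsMetricOn U g) {x : Fin n → ℝ}
    (hx : x ∈ U) (i : Fin n) :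
    g x * pdMat i (fun y => (g y)⁻¹) x * g x = -pdMat i g x := by
  have hone : pdMat i (fun y => g y * (g y)⁻¹) x = 0 := by
    ext a b
    have : Set.EqOn (fun y => (g y * (g y)⁻¹) a b)
        (fun _ => (1 : Matrix (Fin n) (Fin n) ℝ) a b) U := fun y hy => by
      simp only [Matrix.mul_nonsing_inv _ (hg.nondeg y hy)]
    rw [pdMat, Matrix.of_apply, pd_congr hU this hx]
    simp [pd]
  rw [pdMat_mul (fun a b => (hg.smooth a b).differentiableAt_of_isOpen hU hx)
    (fun a b => (hg.contDiffOn_inv a b).differentiableAt_of_isOpen hU hx)] at hone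
  rw [eq_neg_of_add_eq_zero_right hone, Matrix.neg_mul, Matrix.mul_assoc,
    Matrix.nonsing_inv_mul _ (hg.nondeg x hx), Matrix.mul_one]

theorem IsMetricOn.sum_mul_Gamma (hg : IsMetricOn U g) {x : Fin n → ℝ} (hx : x ∈ U)
    (i k l : Fin n) :
    ∑ j, g x i j * Gamma g j k l x = (1/2) * (pd k (fun y => g y i l) x +
      pd l (fun y => g y i k) x - pd i (fun y => g y k l) x) := by
  set c : Fin n → ℝ := fun m =>
    pd k (fun y => g y m l) x + pd l (fun y => g y m k) x - pd m (fun y => g y k l) x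
  have h : g x *ᵥ ((g x)⁻¹ *ᵥ c) = c := by
    rw [Matrix.mulVec_mulVec, Matrix.mul_nonsing_inv _ (hg.nondeg x hx), Matrix.one_mulVec]
  rw [show pd k (fun y => g y i l) x + pd l (fun y => g y i k) x -
    pd i (fun y => g y k l) x = (g x *ᵥ ((g x)⁻¹ *ᵥ c)) i from (congrFun h i).symm]
  simp only [mulVec, dotProduct, Gamma, Finset.mul_sum]
  exact Finset.sum_congr rfl fun j _ => Finset.sum_congr rfl fun m _ => by
    simp only [c]; ring

/-- The geodesic equation in momentum form. -/
theorem IsGeodesicOn.hasDerivAt_momentum (hU : IsOpen U) (hg : IsMetricOn U g)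
    {γ : ℝ → Fin n → ℝ} {I : Set ℝ} (hγ : IsGeodesicOn U g γ I) {t : ℝ} (ht : t ∈ I)
    (i : Fin n) :
    HasDerivAt (fun s => ∑ j, g (γ s) i j * deriv (fun r => γ r j) s)
      ((1/2) * ∑ k, ∑ l, pd i (fun y => g y k l) (γ t) *
        deriv (fun r => γ r k) t * deriv (fun r => γ r l) t) t := by
  have hI := hγ.interval.1.mem_nhds ht
  have hx := hγ.mem t ht
  have hv : ∀ k, HasDerivAt (fun s => γ s k) (deriv (fun s => γ s k) t) t := fun k =>
    (((hγ.smooth k).contDiffAt hI).differentiableAt (by simp)).hasDerivAt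
  have ha : ∀ k, HasDerivAt (deriv fun s => γ s k) (-∑ a, ∑ b, Gamma g k a b (γ t) *
      deriv (fun s => γ s a) t * deriv (fun s => γ s b) t) t := by
    intro k
    rw [← eq_neg_of_add_eq_zero_left (hγ.eqn t ht k)]
    exact ((((hγ.smooth k).deriv_of_isOpen hγ.interval.1 (m := (⊤ : ℕ∞)) (by simp)).contDiffAt
      hI).differentiableAt (by simp)).hasDerivAt
  have hg' : ∀ j, HasDerivAt (fun s => g (γ s) i j)
      (∑ k, deriv (fun s => γ s k) t * pd k (fun y => g y i j) (γ t)) t := fun j =>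
    HasDerivAt.comp_pd ((hg.smooth i j).differentiableAt_of_isOpen hU hx) hv
  refine (HasDerivAt.fun_sum fun j _ => (hg' j).mul (ha j)).congr_deriv ?_
  set v : Fin n → ℝ := fun k => deriv (fun s => γ s k) t
  have hΓ : ∑ j, g (γ t) i j * ∑ a, ∑ b, Gamma g j a b (γ t) * v a * v b =
      ∑ a, ∑ b, (∑ j, g (γ t) i j * Gamma g j a b (γ t)) * v a * v b := by
    simp only [Finset.mul_sum, Finset.sum_mul]
    rw [Finset.sum_comm]
    refine Finset.sum_congr rfl fun a _ => ?_
    rw [Finset.sum_comm]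
    exact Finset.sum_congr rfl fun b _ => Finset.sum_congr rfl fun j _ => by ring
  have hsplit : ∑ a, ∑ b, (∑ j, g (γ t) i j * Gamma g j a b (γ t)) * v a * v b =
      (1/2) * ∑ a, ∑ b, v a * pd a (fun y => g y i b) (γ t) * v b +
      (1/2) * ∑ a, ∑ b, v b * pd b (fun y => g y i a) (γ t) * v a -
      (1/2) * ∑ a, ∑ b, pd i (fun y => g y a b) (γ t) * v a * v b := by
    simp only [hg.sum_mul_Gamma hx, Finset.mul_sum, ← Finset.sum_add_distrib,
      ← Finset.sum_sub_distrib]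
    exact Finset.sum_congr rfl fun a _ => Finset.sum_congr rfl fun b _ => by ring
  have hswap : ∑ a, ∑ b, v b * pd b (fun y => g y i a) (γ t) * v a =
      ∑ a, ∑ b, v a * pd a (fun y => g y i b) (γ t) * v b := Finset.sum_comm
  have hfirst : ∑ j, (∑ k, v k * pd k (fun y => g y i j) (γ t)) * v j =
      ∑ a, ∑ b, v a * pd a (fun y => g y i b) (γ t) * v b := by
    simp only [Finset.sum_mul]
    exact Finset.sum_comm
  simp only [mul_neg, Finset.sum_add_distrib, Finset.sum_neg_distrib]
  rw [hfirst, hΓ, hsplit, hswap]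
  ring

end Geodesics

theorem second_order_part_of_Laplace_commuter_is_Killing {n : ℕ} (hn : 2 ≤ n) (U : Set (Fin n → ℝ)) (hUo : IsOpen U) (hUc : IsConnected U)
    (g : (Fin n → ℝ) → Matrix (Fin n) (Fin n) ℝ) (hg : IsMetricOn U g)
    (Q : (Fin n → ℝ) → Matrix (Fin n) (Fin n) ℝ)
    (hQs : ∀ i j : Fin n, ContDiffOn ℝ (⊤ : ℕ∞) (fun x => Q x i j) U)
    (hQsym : ∀ x ∈ U, (Q x).IsSymm)
    (V : (Fin n → ℝ) → Fin n → ℝ)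
    (hVs : ∀ ℓ : Fin n, ContDiffOn ℝ (⊤ : ℕ∞) (fun x => V x ℓ) U)
    (hcomm : ∀ f : (Fin n → ℝ) → ℝ, ContDiffOn ℝ (⊤ : ℕ∞) f U → ∀ x ∈ U,
      LaplaceOp g (fun y => assocOp g Q f y + ∑ ℓ, V y ℓ * pd ℓ f y) x =
        assocOp g Q (LaplaceOp g f) x + ∑ ℓ, V x ℓ * pd ℓ (LaplaceOp g f) x) :
    IsKillingTensorOn U g (fun x => g x * Q x * g x) := by
  intro γ I hγ
  have hI := hγ.interval.1
  set v : ℝ → Fin n → ℝ := fun s k => deriv (fun r => γ r k) s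
  set ξ : ℝ → Fin n → ℝ := fun s => g (γ s) *ᵥ v s
  have hF : ∀ s ∈ I, ∑ i, ∑ j, v s i * (g (γ s) * Q (γ s) * g (γ s)) i j * v s j =
      ∑ i, ∑ j, ξ s i * Q (γ s) i j * ξ s j := by
    intro s hs
    have hbil : ∀ (M : Matrix (Fin n) (Fin n) ℝ) (w : Fin n → ℝ),
        ∑ i, ∑ j, w i * M i j * w j = w ⬝ᵥ M *ᵥ w := by
      intro M w
      simp only [dotProduct, mulVec, Finset.mul_sum, mul_assoc]
    rw [hbil, hbil]
    simp only [ξ]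
    rw [← Matrix.mulVec_mulVec, ← Matrix.mulVec_mulVec, Matrix.dotProduct_mulVec,
      ← Matrix.mulVec_transpose, hg.symm _ (hγ.mem s hs)]
  have hderiv : ∀ t ∈ I, HasDerivAt (fun s => ∑ i, ∑ j, ξ s i * Q (γ s) i j * ξ s j) 0 t := by
    intro t ht
    have hx := hγ.mem t ht
    have hv : ∀ k, HasDerivAt (fun s => γ s k) (v t k) t := fun k =>
      (((hγ.smooth k).contDiffAt (hI.mem_nhds ht)).differentiableAt (by simp)).hasDerivAt
    have hQ : ∀ i j, HasDerivAt (fun s => Q (γ s) i j)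
        (∑ k, v t k * pd k (fun y => Q y i j) (γ t)) t := fun i j =>
      HasDerivAt.comp_pd ((hQs i j).differentiableAt_of_isOpen hUo hx) hv
    set ξ' : Fin n → ℝ := fun i => (1/2) * ∑ k, ∑ l, pd i (fun y => g y k l) (γ t) *
      v t k * v t l
    have hξ : ∀ i, HasDerivAt (fun s => ξ s i) (ξ' i) t := fun i =>
      hγ.hasDerivAt_momentum hUo hg ht i
    have hbracket := symbols_poisson_commute hUo hg hQs hQsym hVs hcomm hx (ξ t)
    have hleft : ∑ i, ∑ j, (g (γ t))⁻¹ i j * ξ t i * (ξ t ⬝ᵥ pdMat j Q (γ t) *ᵥ ξ t) =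
        ∑ i, ∑ j, ξ t i * (∑ k, v t k * pd k (fun y => Q y i j) (γ t)) * ξ t j := by
      have hvel : ∀ j, ∑ i, (g (γ t))⁻¹ i j * ξ t i = v t j := by
        intro j
        have hsym : ((g (γ t))⁻¹)ᵀ = (g (γ t))⁻¹ := by
          rw [Matrix.transpose_nonsing_inv, hg.symm _ hx]
        have : ((g (γ t))⁻¹ *ᵥ ξ t) = v t := by
          simp only [ξ]
          rw [Matrix.mulVec_mulVec, Matrix.nonsing_inv_mul _ (hg.nondeg _ hx),
            Matrix.one_mulVec]
        rw [← hsym] at this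
        exact congrFun this j
      rw [Finset.sum_comm]
      simp only [← Finset.sum_mul, hvel]
      simp only [dotProduct, mulVec, pdMat, Matrix.of_apply, Finset.mul_sum, Finset.sum_mul]
      rw [Finset.sum_comm]
      refine Finset.sum_congr rfl fun i _ => ?_
      rw [Finset.sum_comm]
      exact Finset.sum_congr rfl fun j _ => Finset.sum_congr rfl fun k _ => by ring
    have hright : ∑ i, ∑ j, Q (γ t) i j * ξ t i *
          (ξ t ⬝ᵥ pdMat j (fun y => (g y)⁻¹) (γ t) *ᵥ ξ t) =
        -2 * ∑ i, ∑ j, ξ t i * Q (γ t) i j * ξ' j := by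
      have hforce : ∀ j, ξ t ⬝ᵥ pdMat j (fun y => (g y)⁻¹) (γ t) *ᵥ ξ t = -2 * ξ' j := by
        intro j
        have h1 : ξ t ⬝ᵥ pdMat j (fun y => (g y)⁻¹) (γ t) *ᵥ ξ t =
            v t ⬝ᵥ (g (γ t) * pdMat j (fun y => (g y)⁻¹) (γ t) * g (γ t)) *ᵥ v t := by
          rw [← Matrix.mulVec_mulVec, ← Matrix.mulVec_mulVec, Matrix.dotProduct_mulVec (v t),
            ← Matrix.mulVec_transpose, hg.symm _ hx]
        rw [h1, hg.mul_pdMat_inv_mul hUo hx]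
        simp only [ξ', dotProduct, mulVec, pdMat, Matrix.neg_apply, Matrix.of_apply,
          Finset.mul_sum]
        exact Finset.sum_congr rfl fun a _ => Finset.sum_congr rfl fun b _ => by ring
      simp only [hforce, Finset.mul_sum]
      exact Finset.sum_congr rfl fun i _ => Finset.sum_congr rfl fun j _ => by ring
    have hswap : ∑ i, ∑ j, ξ' i * Q (γ t) i j * ξ t j =
        ∑ i, ∑ j, ξ t i * Q (γ t) i j * ξ' j := by
      rw [Finset.sum_comm]
      refine Finset.sum_congr rfl fun i _ => Finset.sum_congr rfl fun j _ => ?_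
      rw [(hQsym _ hx).apply i j]
      ring
    refine (HasDerivAt.fun_sum fun i _ => HasDerivAt.fun_sum fun j _ =>
      ((hξ i).mul (hQ i j)).mul (hξ j)).congr_deriv ?_
    rw [hleft, hright] at hbracket
    simp only [Pi.mul_apply, add_mul, Finset.sum_add_distrib]
    linarith
  intro τ₁ h₁ τ₂ h₂
  rw [hF τ₁ h₁, hF τ₂ h₂]
  exact hI.is_const_of_deriv_eq_zero hγ.interval.2.isPreconnected
    (fun t ht => (hderiv t ht).differentiableAt.differentiableWithinAt)
    (fun t ht => (hderiv t ht).deriv) h₁ h₂
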